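/- (Theorem 2) Let m ≥ 1 and H ≥ 1 be integers, let M : ℝ^S → ℝ^S be a linear map, and set δ_FV := ‖M‖_∞. Let V_0 ∈ ℝ^S and define iterates V_{k+1} = M(T_{μ_{k+1},ν_{k+1}}^m(T^{H−1}V_k)), where for each k the pair (μ_{k+1},ν_{k+1}) is an H-step lookahead policy for V_k. Let δ_app ≥ 0 satisfy ‖M J^{μ_{k+1},ν_{k+1}} − J^{μ_{k+1},ν_{k+1}}‖_∞ ≤ δ_app for all k, and suppose κ := α^{H−1} + (δ_FV·α^{m+H−1} + α^{H−1})·(1+α)/(1−α) < 1. Then for all k ≥ 0, ‖V_k − J*‖_∞ ≤ κ^k·‖V_0 − J*‖_∞ + δ_app/(1−κ); in particular limsup_{k→∞} ‖V_k − J*‖_∞ ≤ δ_app/(1−κ). -/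

import Mathlib

open Finset Filter Topology Matrix

noncomputable section

/-- The probability simplex over a finite subset `D` of actions: nonnegative
weights summing to one over `D` and vanishing outside `D`. -/
def simplex {A : Type*} [Fintype A] (D : Finset A) : Set (A → ℝ) :=
  {p | (∀ a, 0 ≤ p a) ∧ (∑ a ∈ D, p a = 1) ∧ ∀ a ∉ D, p a = 0}

/-- A finite two-player zero-sum discounted Markov game. `S` is the state space,
`A` the maximizer's global action type, `B` the minimizer's global action type. -/
structure MarkovGame (S A B : Type*) [Fintype S] [Fintype A] [Fintype B] where
  U : S → Finset A
  W : S → Finset B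
  U_nonempty : ∀ s, (U s).Nonempty
  W_nonempty : ∀ s, (W s).Nonempty
  P : S → A → B → S → ℝ
  P_nonneg : ∀ s u v s', 0 ≤ P s u v s'
  P_sum : ∀ s, ∀ u ∈ U s, ∀ v ∈ W s, ∑ s', P s u v s' = 1
  g : S → A → B → ℝ
  g_nonneg : ∀ s u v, 0 ≤ g s u v
  g_le_one : ∀ s u v, g s u v ≤ 1
  α : ℝ
  α_pos : 0 < α
  α_lt_one : α < 1

namespace MarkovGame

variable {S A B : Type*} [Fintype S] [Fintype A] [Fintype B]

/-- The state-action value matrix `A_{V,s}(u,v) = g(s,u,v) + α Σ_{s'} P(s'|s,u,v) V(s')`. -/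
def Aval (G : MarkovGame S A B) (V : S → ℝ) (s : S) (u : A) (v : B) : ℝ :=
  G.g s u v + G.α * ∑ s', G.P s u v s' * V s'

/-- A policy pair assigns to each state probability vectors over the available actions. -/
def IsPolicy (G : MarkovGame S A B) (μ : S → A → ℝ) (ν : S → B → ℝ) : Prop :=
  ∀ s, μ s ∈ simplex (G.U s) ∧ ν s ∈ simplex (G.W s)

/-- The Bellman operator of a policy pair: `(T_{μ,ν}V)(s) = μ(s)ᵀ A_{V,s} ν(s)`. -/
def Tpol (G : MarkovGame S A B) (μ : S → A → ℝ) (ν : S → B → ℝ) (V : S → ℝ) : S → ℝ :=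
  fun s => ∑ u ∈ G.U s, ∑ v ∈ G.W s, μ s u * ν s v * G.Aval V s u v

/-- The Bellman optimality operator:
`(TV)(s) = max_{p ∈ Δ(U(s))} min_{q ∈ Δ(V(s))} pᵀ A_{V,s} q`. -/
def T (G : MarkovGame S A B) (V : S → ℝ) : S → ℝ :=
  fun s => sSup {x | ∃ p ∈ simplex (G.U s),
    x = sInf {y | ∃ q ∈ simplex (G.W s),
      y = ∑ u ∈ G.U s, ∑ v ∈ G.W s, p u * q v * G.Aval V s u v}}

/-- The transition matrix `P_{μ,ν}` of a policy pair. -/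
def Ppol (G : MarkovGame S A B) (μ : S → A → ℝ) (ν : S → B → ℝ) : Matrix S S ℝ :=
  Matrix.of fun s s' => ∑ u ∈ G.U s, ∑ v ∈ G.W s, μ s u * ν s v * G.P s u v s'

/-- The expected one-step reward `g_{μ,ν}` of a policy pair. -/
def gpol (G : MarkovGame S A B) (μ : S → A → ℝ) (ν : S → B → ℝ) : S → ℝ :=
  fun s => ∑ u ∈ G.U s, ∑ v ∈ G.W s, μ s u * ν s v * G.g s u v

/-- `(μ,ν)` is an `H`-step lookahead policy for `V` if it is a policy pair and
`T_{μ,ν}(T^{H-1}V) = T^H V`. -/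
def IsLookahead (G : MarkovGame S A B) (H : ℕ) (μ : S → A → ℝ) (ν : S → B → ℝ)
    (V : S → ℝ) : Prop :=
  G.IsPolicy μ ν ∧ G.Tpol μ ν (G.T^[H - 1] V) = G.T^[H] V

end MarkovGame

/-- The payoff `pᵀ K q` of a matrix game restricted to the actions in `D` and `E`. -/
def payoff {A B : Type*} (D : Finset A) (E : Finset B) (K : A → B → ℝ)
    (p : A → ℝ) (q : B → ℝ) : ℝ :=
  ∑ u ∈ D, ∑ v ∈ E, p u * q v * K u v

/-- The max-min value of a matrix game restricted to the actions in `D` and `E`. -/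
def maxmin {A B : Type*} [Fintype A] [Fintype B] (D : Finset A) (E : Finset B)
    (K : A → B → ℝ) : ℝ :=
  sSup {x | ∃ p ∈ simplex D, x = sInf {y | ∃ q ∈ simplex E, y = payoff D E K p q}}

section MatrixGame

variable {A B : Type*} [Fintype A] [Fintype B] {D : Finset A} {E : Finset B}

lemma simplex_nonempty (hD : D.Nonempty) : (simplex D).Nonempty := by
  classical
  obtain ⟨a, ha⟩ := hD
  refine ⟨Pi.single a 1, fun b => ?_, ?_, fun b hb => ?_⟩
  · by_cases h : b = a
    · subst h; simp
    · simp [h]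
  · simp [Finset.sum_pi_single', ha]
  · have h : b ≠ a := fun h => hb (h ▸ ha)
    simp [h]

lemma payoff_le_add {K L : A → B → ℝ} {c : ℝ}
    (h : ∀ u ∈ D, ∀ v ∈ E, K u v ≤ L u v + c) {p : A → ℝ} {q : B → ℝ}
    (hp : p ∈ simplex D) (hq : q ∈ simplex E) :
    payoff D E K p q ≤ payoff D E L p q + c := by
  have hc : ∑ u ∈ D, ∑ v ∈ E, p u * q v * c = c := by
    rw [← Finset.sum_congr rfl fun u _ => Finset.sum_mul .., ← Finset.sum_mul,
      ← Finset.sum_mul_sum, hp.2.1, hq.2.1, one_mul, one_mul]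
  calc payoff D E K p q ≤ ∑ u ∈ D, ∑ v ∈ E, p u * q v * (L u v + c) :=
        Finset.sum_le_sum fun u hu => Finset.sum_le_sum fun v hv =>
          mul_le_mul_of_nonneg_left (h u hu v hv) (mul_nonneg (hp.1 u) (hq.1 v))
    _ = payoff D E L p q + c := by
        simp only [mul_add, Finset.sum_add_distrib, hc, payoff]

lemma exists_abs_payoff_le (D : Finset A) (E : Finset B) (K : A → B → ℝ) :
    ∃ C, ∀ p ∈ simplex D, ∀ q ∈ simplex E, |payoff D E K p q| ≤ C := by
  have hK : ∀ u v, |K u v| ≤ ∑ u, ∑ v, |K u v| := fun u v =>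
    (Finset.single_le_sum (f := fun v => |K u v|) (fun _ _ => abs_nonneg _)
      (Finset.mem_univ v)).trans
    (Finset.single_le_sum (f := fun u => ∑ v, |K u v|)
      (fun _ _ => Finset.sum_nonneg fun _ _ => abs_nonneg _) (Finset.mem_univ u))
  refine ⟨∑ u, ∑ v, |K u v|, fun p hp q hq => abs_le.2 ⟨?_, ?_⟩⟩
  · have := payoff_le_add (K := fun _ _ => 0) (L := K)
      (fun u _ v _ => by linarith [(abs_le.1 (hK u v)).1]) hp hq
    simp only [payoff, mul_zero, Finset.sum_const_zero] at this ⊢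
    linarith
  · have := payoff_le_add (K := K) (L := fun _ _ => 0)
      (fun u _ v _ => by linarith [(abs_le.1 (hK u v)).2]) hp hq
    simp only [payoff, mul_zero, Finset.sum_const_zero] at this ⊢
    linarith

lemma maxmin_le_add (hD : D.Nonempty) (hE : E.Nonempty) {K L : A → B → ℝ} {c : ℝ}
    (h : ∀ u ∈ D, ∀ v ∈ E, K u v ≤ L u v + c) : maxmin D E K ≤ maxmin D E L + c := by
  obtain ⟨p₀, hp₀⟩ := simplex_nonempty hD
  obtain ⟨q₀, hq₀⟩ := simplex_nonempty hE
  obtain ⟨C, hC⟩ := exists_abs_payoff_le D E K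
  obtain ⟨C', hC'⟩ := exists_abs_payoff_le D E L
  refine csSup_le ⟨_, p₀, hp₀, rfl⟩ ?_
  rintro _ ⟨p, hp, rfl⟩
  have hinf : sInf {y | ∃ q ∈ simplex E, y = payoff D E K p q} - c ≤
      sInf {y | ∃ q ∈ simplex E, y = payoff D E L p q} := by
    refine le_csInf ⟨_, q₀, hq₀, rfl⟩ ?_
    rintro _ ⟨q, hq, rfl⟩
    have hle := csInf_le (s := {y | ∃ q ∈ simplex E, y = payoff D E K p q})
      ⟨-C, by rintro _ ⟨q, hq, rfl⟩; exact (abs_le.1 (hC p hp q hq)).1⟩ ⟨q, hq, rfl⟩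
    linarith [payoff_le_add h hp hq]
  have hsup : sInf {y | ∃ q ∈ simplex E, y = payoff D E L p q} ≤ maxmin D E L := by
    refine le_csSup ⟨C', ?_⟩ ⟨p, hp, rfl⟩
    rintro _ ⟨r, hr, rfl⟩
    have hle := csInf_le (s := {y | ∃ q ∈ simplex E, y = payoff D E L r q})
      ⟨-C', by rintro _ ⟨q, hq, rfl⟩; exact (abs_le.1 (hC' r hr q hq)).1⟩ ⟨q₀, hq₀, rfl⟩
    exact hle.trans (abs_le.1 (hC' r hr q₀ hq₀)).2
  linarith

end MatrixGame

namespace MarkovGame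

variable {S A B : Type*} [Fintype S] [Fintype A] [Fintype B] (G : MarkovGame S A B)

lemma Aval_le_add (V V' : S → ℝ) {s : S} {u : A} {v : B} (hu : u ∈ G.U s) (hv : v ∈ G.W s) :
    G.Aval V s u v ≤ G.Aval V' s u v + G.α * ‖V - V'‖ := by
  have h : ∑ s', G.P s u v s' * V s' ≤ ∑ s', G.P s u v s' * V' s' + ‖V - V'‖ := by
    rw [← one_mul ‖V - V'‖, ← G.P_sum s u hu v hv, Finset.sum_mul, ← Finset.sum_add_distrib]
    refine Finset.sum_le_sum fun s' _ => ?_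
    rw [← mul_add]
    refine mul_le_mul_of_nonneg_left ?_ (G.P_nonneg _ _ _ _)
    have := (le_abs_self _).trans (norm_le_pi_norm (V - V') s')
    rw [Pi.sub_apply] at this
    linarith
  have := mul_le_mul_of_nonneg_left h G.α_pos.le
  simp only [Aval]
  linarith

/-- An operator shifted up by at most `c * ‖V - V'‖` in every coordinate is `c`-Lipschitz. -/
lemma norm_sub_le_of_le_add {F : (S → ℝ) → S → ℝ} {c : ℝ} (hc : 0 ≤ c)
    (h : ∀ V V' s, F V s ≤ F V' s + c * ‖V - V'‖) (V V' : S → ℝ) :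
    ‖F V - F V'‖ ≤ c * ‖V - V'‖ := by
  refine (pi_norm_le_iff_of_nonneg (by positivity)).2 fun s => abs_le.2 ?_
  have h' := h V' V s
  rw [norm_sub_rev] at h'
  rw [Pi.sub_apply]
  constructor <;> linarith [h V V' s]

lemma norm_T_sub_le (V V' : S → ℝ) : ‖G.T V - G.T V'‖ ≤ G.α * ‖V - V'‖ :=
  norm_sub_le_of_le_add (F := G.T) G.α_pos.le (fun V V' s =>
    maxmin_le_add (K := G.Aval V s) (L := G.Aval V' s) (G.U_nonempty s) (G.W_nonempty s)
      fun _ hu _ hv => G.Aval_le_add V V' hu hv) V V'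

lemma norm_Tpol_sub_le {μ : S → A → ℝ} {ν : S → B → ℝ} (h : G.IsPolicy μ ν) (V V' : S → ℝ) :
    ‖G.Tpol μ ν V - G.Tpol μ ν V'‖ ≤ G.α * ‖V - V'‖ :=
  norm_sub_le_of_le_add (F := G.Tpol μ ν) G.α_pos.le (fun V V' s =>
    payoff_le_add (K := G.Aval V s) (L := G.Aval V' s)
      (fun _ hu _ hv => G.Aval_le_add V V' hu hv) (h s).1 (h s).2) V V'

end MarkovGame

lemma norm_iterate_sub_le {E : Type*} [SeminormedAddCommGroup E] {F : E → E} {c : ℝ} (hc : 0 ≤ c)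
    (hF : ∀ x y, ‖F x - F y‖ ≤ c * ‖x - y‖) {z : E} (hz : F z = z) (n : ℕ) (x : E) :
    ‖F^[n] x - z‖ ≤ c ^ n * ‖x - z‖ := by
  induction n with
  | zero => simp
  | succ n ih =>
    rw [Function.iterate_succ_apply', pow_succ', mul_assoc]
    calc ‖F (F^[n] x) - z‖ = ‖F (F^[n] x) - F z‖ := by rw [hz]
      _ ≤ c * ‖F^[n] x - z‖ := hF _ _
      _ ≤ c * (c ^ n * ‖x - z‖) := mul_le_mul_of_nonneg_left ih hc

/-- For a `c`-contraction `F`, the residual at `x` controls the distance to the fixed point. -/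
lemma norm_sub_fixedPoint_le {E : Type*} [SeminormedAddCommGroup E] {F : E → E} {c : ℝ}
    (hc : c < 1) (hF : ∀ x y, ‖F x - F y‖ ≤ c * ‖x - y‖) {z : E} (hz : F z = z) (x : E) :
    ‖x - z‖ ≤ ‖x - F x‖ / (1 - c) := by
  have h := hF x z
  rw [hz] at h
  rw [le_div_iff₀ (by linarith)]
  linarith [norm_sub_le_norm_sub_add_norm_sub x (F x) z]

/-- The error of one step of approximate policy iteration with `H`-step lookahead. -/
lemma MarkovGame.norm_step_sub_le {S A B : Type*} [Fintype S] [Fintype A] [Fintype B]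
    (G : MarkovGame S A B) (m : ℕ) {H : ℕ} (hH : 1 ≤ H) (M : (S → ℝ) →L[ℝ] (S → ℝ))
    {V J Jstar : S → ℝ} {μ : S → A → ℝ} {ν : S → B → ℝ} (hLA : G.IsLookahead H μ ν V)
    (hJ : G.Tpol μ ν J = J) (hJstar : G.T Jstar = Jstar) :
    ‖M ((G.Tpol μ ν)^[m] (G.T^[H - 1] V)) - Jstar‖ ≤
      (G.α ^ (H - 1) + (‖M‖ * G.α ^ (m + H - 1) + G.α ^ (H - 1)) * (1 + G.α) / (1 - G.α)) *
        ‖V - Jstar‖ + ‖M J - J‖ := by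
  obtain ⟨hpol, hgreedy⟩ := hLA
  have hα := G.α_pos.le
  have hα1 : 0 < 1 - G.α := sub_pos.2 G.α_lt_one
  set W := G.T^[H - 1] V with hW
  have hTW : G.Tpol μ ν W = G.T W := by
    rw [hgreedy, hW, ← Function.iterate_succ_apply' G.T, Nat.succ_eq_add_one, Nat.sub_add_cancel hH]
  have hWstar : ‖W - Jstar‖ ≤ G.α ^ (H - 1) * ‖V - Jstar‖ :=
    norm_iterate_sub_le hα G.norm_T_sub_le hJstar _ _
  have hres : ‖W - G.Tpol μ ν W‖ ≤ (1 + G.α) * ‖W - Jstar‖ := by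
    have h := G.norm_T_sub_le Jstar W
    rw [hJstar, norm_sub_rev Jstar W] at h
    rw [hTW]
    linarith [norm_sub_le_norm_sub_add_norm_sub W Jstar (G.T W)]
  have hWJ : ‖W - J‖ ≤ (1 + G.α) / (1 - G.α) * (G.α ^ (H - 1) * ‖V - Jstar‖) := by
    refine (norm_sub_fixedPoint_le G.α_lt_one (G.norm_Tpol_sub_le hpol) hJ W).trans ?_
    rw [div_mul_eq_mul_div]
    gcongr
    exact hres.trans (by gcongr)
  have hfit : ‖M ((G.Tpol μ ν)^[m] W) - M J‖ ≤
      ‖M‖ * (G.α ^ m * ((1 + G.α) / (1 - G.α) * (G.α ^ (H - 1) * ‖V - Jstar‖))) := by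
    rw [← map_sub]
    refine (M.le_opNorm _).trans ?_
    gcongr
    refine (norm_iterate_sub_le hα (G.norm_Tpol_sub_le hpol) hJ m W).trans ?_
    gcongr
  have h₁ := norm_sub_le_norm_sub_add_norm_sub (M ((G.Tpol μ ν)^[m] W)) (M J) Jstar
  have h₂ := norm_sub_le_norm_sub_add_norm_sub (M J) J Jstar
  have h₃ := norm_sub_le_norm_sub_add_norm_sub J W Jstar
  rw [norm_sub_rev J W] at h₃
  rw [Nat.add_sub_assoc hH, pow_add, mul_div_assoc]
  linarith

lemma le_geometric_of_le_mul_add {e : ℕ → ℝ} {κ δ : ℝ} (hκ₀ : 0 ≤ κ) (hκ : κ < 1) (hδ : 0 ≤ δ)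
    (h : ∀ k, e (k + 1) ≤ κ * e k + δ) (k : ℕ) : e k ≤ κ ^ k * e 0 + δ / (1 - κ) := by
  have h1 : 0 < 1 - κ := sub_pos.2 hκ
  induction k with
  | zero => simpa using div_nonneg hδ h1.le
  | succ k ih =>
    calc e (k + 1) ≤ κ * (κ ^ k * e 0 + δ / (1 - κ)) + δ := (h k).trans (by gcongr)
      _ = κ ^ (k + 1) * e 0 + δ / (1 - κ) := by field_simp; ring

/-- Theorem 2: For the iterates
`V_{k+1} = M(T_{μ_{k+1},ν_{k+1}}^m(T^{H−1}V_k))` with `H`-step lookahead policies,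
`δ_FV := ‖M‖`, approximation error `δ_app`, and
`κ := α^{H−1} + (δ_FV α^{m+H−1} + α^{H−1})(1+α)/(1−α) < 1`, we have
`‖V_k − J*‖_∞ ≤ κ^k ‖V_0 − J*‖_∞ + δ_app/(1−κ)` and
`limsup_k ‖V_k − J*‖_∞ ≤ δ_app/(1−κ)`. -/
theorem stmt_14 {S A B : Type*} [Fintype S] [Fintype A] [Fintype B]
    (G : MarkovGame S A B) (m H : ℕ) (hm : 1 ≤ m) (hH : 1 ≤ H)
    (M : (S → ℝ) →L[ℝ] (S → ℝ))
    (Vseq : ℕ → S → ℝ) (μ : ℕ → S → A → ℝ) (ν : ℕ → S → B → ℝ)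
    (hLA : ∀ k, G.IsLookahead H (μ k) (ν k) (Vseq k))
    (hiter : ∀ k, Vseq (k + 1) = M ((G.Tpol (μ k) (ν k))^[m] (G.T^[H - 1] (Vseq k))))
    (Jpol : ℕ → S → ℝ) (hJpol : ∀ k, G.Tpol (μ k) (ν k) (Jpol k) = Jpol k)
    (δapp : ℝ) (hδapp : 0 ≤ δapp) (happ : ∀ k, ‖M (Jpol k) - Jpol k‖ ≤ δapp)
    (κ : ℝ)
    (hκdef : κ = G.α ^ (H - 1) +
      (‖M‖ * G.α ^ (m + H - 1) + G.α ^ (H - 1)) * (1 + G.α) / (1 - G.α))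
    (hκ : κ < 1)
    (Jstar : S → ℝ) (hJ : G.T Jstar = Jstar) :
    (∀ k, ‖Vseq k - Jstar‖ ≤ κ ^ k * ‖Vseq 0 - Jstar‖ + δapp / (1 - κ)) ∧
    limsup (fun k => ‖Vseq k - Jstar‖) atTop ≤ δapp / (1 - κ) := by
  have hα := G.α_pos
  have hα1 : 0 < 1 - G.α := sub_pos.2 G.α_lt_one
  have hκ₀ : 0 ≤ κ := by rw [hκdef]; positivity
  have hbound := le_geometric_of_le_mul_add (e := fun k => ‖Vseq k - Jstar‖) hκ₀ hκ hδapp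
    fun k => by
      have := G.norm_step_sub_le m hH M (hLA k) (hJpol k) hJ
      rw [← hκdef, ← hiter] at this
      linarith [happ k]
  refine ⟨hbound, ?_⟩
  have hlim : Tendsto (fun k => κ ^ k * ‖Vseq 0 - Jstar‖ + δapp / (1 - κ)) atTop
      (𝓝 (δapp / (1 - κ))) := by
    simpa using ((tendsto_pow_atTop_nhds_zero_of_lt_one hκ₀ hκ).mul_const
      ‖Vseq 0 - Jstar‖).add_const (δapp / (1 - κ))
  rw [← hlim.limsup_eq]
  exact limsup_le_limsup (Eventually.of_forall hbound)
    (isBoundedUnder_of ⟨0, fun _ => norm_nonneg _⟩).isCoboundedUnder_le hlim.isBoundedUnder_le
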